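/- Let p, q, p', q' be natural numbers. If Ψ_S^{2p}·Ψ_{S'}^{2p'} = Ψ_T^{2q}·Ψ_{T'}^{2q'} holds in the ring Q, then p = q = p' = q' = 0. (This handles one of the mixed-sign cases in the proof of the proposition that img(m) ≠ img(m').) -/

import Mathlib

/- Λ₄ is the group algebra of ℝ⁴ over ℝ; `E β` is the Novikov monomial e^β,
   δ i the standard basis vectors of ℝ⁴.  `Q` is the Künneth model of the
   quantum homology of M = (S²×S²)×(S²×S²) with form (ω₀⊕λω₀)⊕(−ω₀⊕−λω₀):
   the quotient of Λ₄[U₁,U₂,U₃,U₄] by U₁²−e^{−δ₁}, U₂²−e^{−δ₂}, U₃²−e^{δ₃},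
   U₄²−e^{δ₄}; `u i` are the images of the variables (u₁,u₂,w₃,w₄). -/

noncomputable section

abbrev Λ₄ : Type := AddMonoidAlgebra ℝ (Fin 4 → ℝ)

def E (β : Fin 4 → ℝ) : Λ₄ := AddMonoidAlgebra.single β 1

def δ (i : Fin 4) : Fin 4 → ℝ := Pi.single i 1

def qRel : Ideal (MvPolynomial (Fin 4) Λ₄) :=
  Ideal.span {MvPolynomial.X 0 ^ 2 - MvPolynomial.C (E (-δ 0)),
              MvPolynomial.X 1 ^ 2 - MvPolynomial.C (E (-δ 1)),
              MvPolynomial.X 2 ^ 2 - MvPolynomial.C (E (δ 2)),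
              MvPolynomial.X 3 ^ 2 - MvPolynomial.C (E (δ 3))}

abbrev Q : Type := MvPolynomial (Fin 4) Λ₄ ⧸ qRel

def u (i : Fin 4) : Q := Ideal.Quotient.mk qRel (MvPolynomial.X i)

def eQ (β : Fin 4 → ℝ) : Q := algebraMap Λ₄ Q (E β)

/-- Ψ_S = (u₁+u₂)·e^{(1/2+h)δ₁−hδ₂} -/
def ΨS (h : ℝ) : Q := (u 0 + u 1) * eQ ((1 / 2 + h) • δ 0 - h • δ 1)

/-- Ψ_T = −(w₃+w₄)·e^{−(1/2+h)δ₃+hδ₄} -/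
def ΨT (h : ℝ) : Q := -((u 2 + u 3) * eQ (-((1 / 2 + h) • δ 2) + h • δ 3))

/-- Ψ_{S'} = (u₁−w₄)·e^{(1/2+h)δ₁+hδ₄} -/
def ΨS' (h : ℝ) : Q := (u 0 - u 3) * eQ ((1 / 2 + h) • δ 0 + h • δ 3)

/-- Ψ_{T'} = (u₂−w₃)·e^{−(1/2+h)δ₃−hδ₂} -/
def ΨT' (h : ℝ) : Q := (u 1 - u 2) * eQ (-((1 / 2 + h) • δ 2) - h • δ 1)

/-- The augmentation of the group algebra, sending every Novikov monomial to `1`. -/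
def augmentation : Λ₄ →ₐ[ℝ] ℝ := AddMonoidAlgebra.lift ℝ ℝ (Fin 4 → ℝ) 1

lemma augmentation_E (β : Fin 4 → ℝ) : augmentation (E β) = 1 := by
  simp [augmentation, E]

/-- Every choice of signs for the generators extends to a real character of `Q` that is
trivial on the Novikov monomials. -/
lemma exists_sign_character (s : Fin 4 → ℝ) (hs : ∀ i, s i ^ 2 = 1) :
    ∃ f : Q →+* ℝ, (∀ i, f (u i) = s i) ∧ ∀ β, f (eQ β) = 1 := by
  let g : MvPolynomial (Fin 4) Λ₄ →+* ℝ := MvPolynomial.eval₂Hom augmentation.toRingHom s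
  have hg : ∀ a ∈ qRel, g a = 0 := by
    intro a ha
    have hle : qRel ≤ RingHom.ker g := by
      refine Ideal.span_le.2 ?_
      rintro x (rfl | rfl | rfl | rfl) <;> simp [RingHom.mem_ker, g, augmentation_E, hs]
    exact hle ha
  refine ⟨Ideal.Quotient.lift qRel g hg, fun i => ?_, fun β => ?_⟩
  · simp [u, g]
  · change g (MvPolynomial.C (E β)) = 1
    simp [g, augmentation_E]

lemma sign_character_relation {h : ℝ} {p q p' q' : ℕ}
    (heq : ΨS h ^ (2 * p) * ΨS' h ^ (2 * p') = ΨT h ^ (2 * q) * ΨT' h ^ (2 * q'))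
    {a b c d : ℝ} (ha : a ^ 2 = 1) (hb : b ^ 2 = 1) (hc : c ^ 2 = 1) (hd : d ^ 2 = 1) :
    (a + b) ^ (2 * p) * (a - d) ^ (2 * p') = (-(c + d)) ^ (2 * q) * (b - c) ^ (2 * q') := by
  obtain ⟨f, hu, he⟩ := exists_sign_character ![a, b, c, d]
    (by intro i; fin_cases i <;> assumption)
  have h0 : f (u 0) = a := hu 0
  have h1 : f (u 1) = b := hu 1
  have h2 : f (u 2) = c := hu 2
  have h3 : f (u 3) = d := hu 3
  simpa only [ΨS, ΨS', ΨT, ΨT', map_mul, map_pow, map_add, map_sub, map_neg, h0, h1, h2, h3, he,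
    mul_one] using congrArg f heq

/-- If Ψ_S^{2p}·Ψ_{S'}^{2p'} = Ψ_T^{2q}·Ψ_{T'}^{2q'} in Q then p = q = p' = q' = 0. -/
theorem seidel_products_mixed_case_one
    (lam : ℝ) (hlam : 1 < lam) (h : ℝ) (hh : h = 1 / (6 * lam * (lam - 1)))
    (p q p' q' : ℕ)
    (heq : ΨS h ^ (2 * p) * ΨS' h ^ (2 * p') = ΨT h ^ (2 * q) * ΨT' h ^ (2 * q')) :
    p = 0 ∧ q = 0 ∧ p' = 0 ∧ q' = 0 := by
  have h₁ := sign_character_relation heq (a := 1) (b := -1) (c := 1) (d := 1)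
    (by norm_num) (by norm_num) (by norm_num) (by norm_num)
  have h₂ := sign_character_relation heq (a := 1) (b := 1) (c := 1) (d := -1)
    (by norm_num) (by norm_num) (by norm_num) (by norm_num)
  refine ⟨?_, ?_, ?_, ?_⟩ <;> by_contra hne
  · norm_num [hne] at h₁
  · norm_num [hne] at h₂
  · norm_num [hne] at h₁
  · norm_num [hne] at h₂

end
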